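/- Let θ, φ ∈ ℝ/ℤ be distinct angles with θ not periodic under the doubling map, let n ≥ 1 be an integer with dist(φ, θ) < 2^{−n}, and suppose k := diff(ν(θ), ν(φ)) is finite. Then there exists an angle θ* ∈ ℝ/ℤ with 2^k θ* = θ* and dist(θ, θ*) < 2^{−n}; consequently dist(2^k θ, θ) ≤ 2^{k−n} + 2^{−n}. -/

import Mathlib

noncomputable instance : Fact ((0:ℝ) < 1) := ⟨one_pos⟩

/-- The representative in `[0,1)` of a point of the circle `ℝ/ℤ`. -/
noncomputable def rep (x : AddCircle (1 : ℝ)) : ℝ :=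
  (AddCircle.equivIco 1 0 x : ℝ)

open Classical in
/-- The kneading sequence of the angle `θ`: with `t ∈ [0,1)` the representative of `θ`,
the `k`-th entry records whether `2^(k-1) θ` lies in the open arc `A₁ = (t/2, (t+1)/2)`
containing `θ`, in the complementary open arc `A₀`, or is one of the two boundary points
`θ/2, (θ+1)/2` (the symbol `⋆`, encoded as `none`). Positions start at `1`. -/
noncomputable def nu (θ : AddCircle (1 : ℝ)) (k : ℕ) : Option Bool :=
  let t := rep θ
  let x := rep ((2 ^ (k - 1) : ℕ) • θ)
  if x = t / 2 ∨ x = (t + 1) / 2 then none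
  else if t / 2 < x ∧ x < (t + 1) / 2 then some true
  else some false

/-- Position of the first genuinely different entry (positions `≥ 1`), with `⋆ = none`
acting as a wildcard; `∞` if there is none. -/
noncomputable def diffW (a b : ℕ → Option Bool) : ℕ∞ :=
  sInf {k : ℕ∞ | ∃ n : ℕ, k = (n : ℕ∞) ∧ 1 ≤ n ∧
    ∃ x y : Bool, a n = some x ∧ b n = some y ∧ x ≠ y}


/-- `θ` is periodic under the angle-doubling map. -/
def DoublingPeriodic (θ : AddCircle (1 : ℝ)) : Prop :=
  ∃ n, 1 ≤ n ∧ (2 ^ n : ℕ) • θ = θ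

theorem coe_rep (x : AddCircle (1 : ℝ)) : ((rep x : ℝ) : AddCircle (1 : ℝ)) = x :=
  (AddCircle.equivIco 1 0).symm_apply_apply x

theorem rep_nonneg (x : AddCircle (1 : ℝ)) : 0 ≤ rep x :=
  (AddCircle.equivIco 1 0 x).2.1

theorem rep_lt_one (x : AddCircle (1 : ℝ)) : rep x < 1 :=
  (AddCircle.equivIco 1 0 x).2.2.trans_eq (zero_add 1)

theorem rep_nsmul (m : ℕ) (x : AddCircle (1 : ℝ)) :
    rep (m • x) = Int.fract (m * rep x) := by
  conv_lhs => rw [← coe_rep x, ← AddCircle.coe_nsmul, rep]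
  rw [AddCircle.coe_equivIco_mk_apply, div_one, mul_one, nsmul_eq_mul]

/-- The `k`-th kneading entry is the parity of `⌊(2 ^ k - 1) t⌋`, with `t ∈ [0,1)` the
representative of the angle. -/
theorem even_floor_of_nu {θ : AddCircle (1 : ℝ)} {k : ℕ} (hk : 1 ≤ k) {b : Bool}
    (h : nu θ k = some b) : Even ⌊((2 : ℝ) ^ k - 1) * rep θ⌋ ↔ b = true := by
  obtain ⟨j, rfl⟩ : ∃ j, k = j + 1 := ⟨k - 1, by omega⟩
  have h0 := rep_nonneg θ
  have h1 := rep_lt_one θ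
  simp only [nu, Nat.add_sub_cancel, rep_nsmul] at h
  push_cast at h
  set t := rep θ
  set m := ⌊(2 : ℝ) ^ j * t⌋ with hm
  have hx := Int.self_sub_floor ((2 : ℝ) ^ j * t)
  have hx0 := Int.fract_nonneg ((2 : ℝ) ^ j * t)
  have hx1 := Int.fract_lt_one ((2 : ℝ) ^ j * t)
  rw [← hm] at hx
  set x := Int.fract ((2 : ℝ) ^ j * t)
  have hN : ((2 : ℝ) ^ (j + 1) - 1) * t = 2 * m + (2 * x - t) := by
    rw [← hx]; ring
  rw [hN]
  split_ifs at h with hs hin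
  · have hb : b = true := by simpa using h.symm
    have : ⌊2 * (m : ℝ) + (2 * x - t)⌋ = 2 * m := by
      rw [Int.floor_eq_iff]
      push_cast
      constructor <;> linarith [hin.1, hin.2]
    simp [this, hb]
  · have hb : b = false := by simpa using h.symm
    push Not at hs
    rcases lt_or_gt_of_ne hs.1 with hlt | hgt
    · have : ⌊2 * (m : ℝ) + (2 * x - t)⌋ = 2 * m - 1 := by
        rw [Int.floor_eq_iff]
        push_cast
        constructor <;> linarith
      rw [this, hb]
      simp
    · have hge : (t + 1) / 2 ≤ x := not_lt.1 fun hlt => hin ⟨hgt, hlt⟩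
      have : ⌊2 * (m : ℝ) + (2 * x - t)⌋ = 2 * m + 1 := by
        rw [Int.floor_eq_iff]
        push_cast
        constructor <;> linarith
      rw [this, hb]
      simp

theorem exists_ne_of_diffW_eq {a b : ℕ → Option Bool} {k : ℕ} (hk : diffW a b = (k : ℕ∞)) :
    1 ≤ k ∧ ∃ x y : Bool, a k = some x ∧ b k = some y ∧ x ≠ y := by
  unfold diffW at hk
  set S := {k : ℕ∞ | ∃ n : ℕ, k = (n : ℕ∞) ∧ 1 ≤ n ∧
    ∃ x y : Bool, a n = some x ∧ b n = some y ∧ x ≠ y}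
  have hS : S.Nonempty := by
    by_contra h
    rw [Set.not_nonempty_iff_eq_empty.1 h, sInf_empty] at hk
    exact ENat.top_ne_natCast k hk
  obtain ⟨l, hl, hl'⟩ := hk ▸ csInf_mem hS
  obtain rfl : k = l := by exact_mod_cast hl
  exact hl'

theorem exists_int_mem_uIcc_of_floor_ne {x y : ℝ} (h : ⌊x⌋ ≠ ⌊y⌋) :
    ∃ m : ℤ, (m : ℝ) ∈ Set.uIcc x y := by
  rcases lt_or_gt_of_ne h with h | h
  · exact ⟨⌊y⌋, Set.mem_uIcc.2 (.inl ⟨(Int.floor_lt.1 h).le, Int.floor_le y⟩)⟩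
  · exact ⟨⌊x⌋, Set.mem_uIcc.2 (.inr ⟨(Int.floor_lt.1 h).le, Int.floor_le x⟩)⟩

theorem dist_coe_le_abs (s t : ℝ) :
    dist (s : AddCircle (1 : ℝ)) (t : AddCircle (1 : ℝ)) ≤ |s - t| := by
  rw [dist_eq_norm, ← AddCircle.coe_sub]
  exact QuotientAddGroup.norm_mk_le_norm

/-- Two representatives in `[0,1)` are either as close as the angles, or the angles are
close across `0`. -/
theorem abs_rep_sub_lt_or_dist_zero_lt {θ φ : AddCircle (1 : ℝ)} {r : ℝ}
    (h : dist φ θ < r) : |rep φ - rep θ| < r ∨ dist θ 0 < r := by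
  have h0 := rep_nonneg θ
  have h1 := rep_lt_one θ
  have h2 := rep_nonneg φ
  have h3 := rep_lt_one φ
  have hz (z : ℤ) : dist θ 0 ≤ |rep θ - z| := by
    have hz0 : ((z : ℝ) : AddCircle (1 : ℝ)) = 0 :=
      (AddCircle.coe_eq_zero_iff 1).2 ⟨z, by simp⟩
    simpa only [coe_rep, hz0] using dist_coe_le_abs (rep θ) z
  have hz0 := hz 0
  have hz1 := hz 1
  push_cast at hz0 hz1
  rw [← coe_rep φ, ← coe_rep θ, dist_eq_norm, ← AddCircle.coe_sub, UnitAddCircle.norm_eq] at h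
  set z := round (rep φ - rep θ)
  by_cases hzz : z = 0
  · left
    simpa [hzz] using h
  · right
    rw [abs_lt] at h
    rcases lt_or_gt_of_ne hzz with hlt | hgt
    · have hzle : (z : ℝ) ≤ -1 := by exact_mod_cast Int.le_sub_one_of_lt hlt
      rw [abs_of_nonpos (by linarith)] at hz1
      linarith
    · have hzle : (1 : ℝ) ≤ z := by exact_mod_cast hgt
      rw [abs_of_nonneg (by linarith)] at hz0
      linarith

theorem exists_periodic_dist_lt {θ φ : AddCircle (1 : ℝ)} {r : ℝ} (hd : dist φ θ < r)
    {k : ℕ} (hk : diffW (nu θ) (nu φ) = (k : ℕ∞)) :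
    ∃ θs : AddCircle (1 : ℝ), (2 ^ k : ℕ) • θs = θs ∧ dist θ θs < r := by
  obtain ⟨hk1, a, b, ha, hb, hab⟩ := exists_ne_of_diffW_eq hk
  rcases abs_rep_sub_lt_or_dist_zero_lt hd with h | h
  · have hfl : ⌊((2 : ℝ) ^ k - 1) * rep θ⌋ ≠ ⌊((2 : ℝ) ^ k - 1) * rep φ⌋ := by
      intro heq
      have h1 := even_floor_of_nu hk1 ha
      rw [heq, even_floor_of_nu hk1 hb] at h1
      exact hab (Bool.eq_iff_iff.2 h1).symm
    obtain ⟨m, hm⟩ := exists_int_mem_uIcc_of_floor_ne hfl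
    have hN : (0 : ℝ) < 2 ^ k - 1 := by
      have := one_lt_pow₀ (one_lt_two (α := ℝ)) (Nat.one_le_iff_ne_zero.1 hk1)
      linarith
    set N : ℝ := 2 ^ k - 1 with hNdef
    have hmem : (m : ℝ) / N ∈ Set.uIcc (rep θ) (rep φ) := by
      rw [Set.mem_uIcc] at hm ⊢
      simpa only [le_div_iff₀' hN, div_le_iff₀' hN] using hm
    refine ⟨((m / N : ℝ) : AddCircle (1 : ℝ)), ?_, ?_⟩
    · rw [← sub_eq_zero, ← AddCircle.coe_nsmul, ← AddCircle.coe_sub,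
        AddCircle.coe_eq_zero_iff]
      refine ⟨m, ?_⟩
      have hp : (2 : ℝ) ^ k = N + 1 := by rw [hNdef]; ring
      simp only [zsmul_eq_mul, nsmul_eq_mul, Nat.cast_pow, Nat.cast_ofNat, hp]
      field_simp
      ring
    · calc dist θ ((m / N : ℝ) : AddCircle (1 : ℝ)) ≤ |rep θ - m / N| := by
            simpa only [coe_rep] using dist_coe_le_abs (rep θ) (m / N)
        _ ≤ |rep φ - rep θ| := by
            rw [abs_sub_comm]
            exact Set.abs_sub_left_of_mem_uIcc hmem
        _ < r := h
  · exact ⟨0, smul_zero _, h⟩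

theorem dist_nsmul_self_le {E : Type*} [SeminormedAddCommGroup E] (N : ℕ) {x y : E} {r : ℝ}
    (hy : N • y = y) (h : dist x y ≤ r) : dist (N • x) x ≤ N * r + r := by
  have h1 : dist (N • x) (N • y) ≤ N * dist x y := by
    rw [dist_eq_norm, dist_eq_norm, ← nsmul_sub]
    exact norm_nsmul_le
  calc dist (N • x) x ≤ dist (N • x) (N • y) + dist (N • y) x := dist_triangle _ _ _
    _ = dist (N • x) (N • y) + dist x y := by rw [hy, dist_comm y x]
    _ ≤ N * r + r := by gcongr; exact h1.trans (by gcongr)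

/-- If `θ ≠ φ`, `θ` is non-periodic, `dist(φ,θ) < 2^{-n}` and `k := diff(ν(θ),ν(φ))` is
finite, then there is an angle `θ*` with `2^k θ* = θ*` and `dist(θ,θ*) < 2^{-n}`;
consequently `dist(2^k θ, θ) ≤ 2^{k-n} + 2^{-n}`. -/
theorem periodic_angle_nearby (θ φ : AddCircle (1 : ℝ)) (hne : θ ≠ φ)
    (hnp : ¬ DoublingPeriodic θ) (n : ℕ) (hn : 1 ≤ n)
    (hd : dist φ θ < (2 : ℝ) ^ (-(n : ℤ)))
    (k : ℕ) (hk : diffW (nu θ) (nu φ) = (k : ℕ∞)) :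
    (∃ θs : AddCircle (1 : ℝ), (2 ^ k : ℕ) • θs = θs ∧
      dist θ θs < (2 : ℝ) ^ (-(n : ℤ))) ∧
    dist ((2 ^ k : ℕ) • θ) θ ≤ (2 : ℝ) ^ ((k : ℤ) - n) + (2 : ℝ) ^ (-(n : ℤ)) := by
  obtain ⟨θs, hθs, hlt⟩ := exists_periodic_dist_lt hd hk
  refine ⟨⟨θs, hθs, hlt⟩, (dist_nsmul_self_le _ hθs hlt.le).trans_eq ?_⟩
  rw [sub_eq_add_neg, zpow_add₀ two_ne_zero, zpow_natCast]
  push_cast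
  rfl
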